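/- Let R = S ×_k T be a non-trivial fiber product and let M_1, N_1 be finitely generated S-modules, regarded as R-modules via the surjection R → S. If Tor_1^R(M_1, N_1) = 0, then M_1 = 0 or N_1 = 0. -/

import Mathlib

open CategoryTheory Opposite IsLocalRing

noncomputable section

/-- Vanishing of `Tor_i^A(M, N)`. -/
abbrev TorZero (A : Type) [CommRing A] (M N : Type) [AddCommGroup M] [Module A M]
    [AddCommGroup N] [Module A N] (i : ℕ) : Prop :=
  Subsingleton (((Tor (ModuleCat A) i).obj (ModuleCat.of A M)).obj (ModuleCat.of A N))

/-- Vanishing of `Ext^i_A(M, N)`. -/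
abbrev ExtZero (A : Type) [CommRing A] (M N : Type) [AddCommGroup M] [Module A M]
    [AddCommGroup N] [Module A N] (i : ℕ) : Prop :=
  Subsingleton (((Ext A (ModuleCat A) i).obj (op (ModuleCat.of A M))).obj (ModuleCat.of A N))

/-- `M` has projective dimension at most `n` over `A`:
`Ext^i_A(M, -) = 0` for all `i > n`. -/
def PdLE (A : Type) [CommRing A] (M : Type) [AddCommGroup M] [Module A M] (n : ℕ) : Prop :=
  ∀ (N : ModuleCat A) (i : ℕ), n < i →
    Subsingleton (((Ext A (ModuleCat A) i).obj (op (ModuleCat.of A M))).obj N)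

/-- `N` has injective dimension at most `n` over `A`:
`Ext^i_A(-, N) = 0` for all `i > n`. -/
def IdLE (A : Type) [CommRing A] (N : Type) [AddCommGroup N] [Module A N] (n : ℕ) : Prop :=
  ∀ (X : ModuleCat A) (i : ℕ), n < i →
    Subsingleton (((Ext A (ModuleCat A) i).obj (op X)).obj (ModuleCat.of A N))

/-- The depth of a module over a noetherian local ring, as an extended natural number:
`inf { i | Ext^i_A(k, M) ≠ 0 }`. -/
def depthM (A : Type) [CommRing A] [IsLocalRing A] (M : Type) [AddCommGroup M]
    [Module A M] : ℕ∞ :=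
  sInf {n : ℕ∞ | ∃ i : ℕ, n = i ∧
    ¬ Subsingleton (((Ext A (ModuleCat A) i).obj
        (op (ModuleCat.of A (A ⧸ maximalIdeal A)))).obj (ModuleCat.of A M))}

/-- The fiber product `S ×ₖ T` as a subring of `S × T`. -/
def fiberProd {S T k : Type} [CommRing S] [CommRing T] [CommRing k]
    (πS : S →+* k) (πT : T →+* k) : Subring (S × T) :=
  RingHom.eqLocus (πS.comp (RingHom.fst S T)) (πT.comp (RingHom.snd S T))

/-- The projection from the fiber product to `S`. -/
def ρS {S T k : Type} [CommRing S] [CommRing T] [CommRing k]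
    (πS : S →+* k) (πT : T →+* k) : ↥(fiberProd πS πT) →+* S :=
  (RingHom.fst S T).comp (fiberProd πS πT).subtype

/-- The projection from the fiber product to `T`. -/
def ρT {S T k : Type} [CommRing S] [CommRing T] [CommRing k]
    (πS : S →+* k) (πT : T →+* k) : ↥(fiberProd πS πT) →+* T :=
  (RingHom.snd S T).comp (fiberProd πS πT).subtype

/-- The `i`-th Betti number of a module `M` over a noetherian local ring `A`:
the `k`-dimension of `Tor_i^A(M, k) ⊗_A k`; since `Tor_i^A(M, k)` is annihilated
by the maximal ideal, this is `dim_k Tor_i^A(M, k)`. -/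
noncomputable def betti (A : Type) [CommRing A] [IsLocalRing A] (M : Type) [AddCommGroup M]
    [Module A M] (i : ℕ) : ℕ :=
  let X : ModuleCat A :=
    ((Tor (ModuleCat A) i).obj (ModuleCat.of A M)).obj (ModuleCat.of A (A ⧸ maximalIdeal A))
  Module.finrank (A ⧸ maximalIdeal A) (X ⧸ (maximalIdeal A • (⊤ : Submodule A X)))

/-- A nonzero finitely generated module over a local ring surjects onto the residue field. -/
theorem exists_semilinearMap_residue_ne_zero {S k N : Type*} [CommRing S] [IsLocalRing S] [Field k]
    (π : S →+* k) (hπ : RingHom.ker π = maximalIdeal S)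
    [AddCommGroup N] [Module S N] [Module.Finite S N] [Nontrivial N] :
    ∃ (χ : N →ₛₗ[π] k) (n : N), χ n ≠ 0 := by
  obtain ⟨P, hP, -⟩ := (eq_top_or_exists_le_coatom (⊥ : Submodule S N)).resolve_left bot_ne_top
  obtain ⟨I, hI, ⟨e⟩⟩ := isSimpleModule_iff_quot_maximal.mp (isSimpleModule_iff_isCoatom.mpr hP)
  obtain rfl := eq_maximalIdeal hI
  let f : S →ₛₗ[π] k :=
    { toFun := π, map_add' := π.map_add, map_smul' := π.map_mul }
  let χ : (S ⧸ maximalIdeal S) →ₛₗ[π] k := Submodule.liftQ _ f fun x hx => by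
    rw [← hπ] at hx
    exact hx
  obtain ⟨n, hn⟩ := P.mkQ_surjective (e.symm (Submodule.Quotient.mk 1))
  refine ⟨(χ.comp e.toLinearMap).comp P.mkQ, n, ?_⟩
  have h : χ 1 = 1 := π.map_one
  simp [hn, h]

/-- If `t` lies in the kernel `J` of a surjection `R → k` onto a field, is not killed by some
`R`-linear map `J → k`, and annihilates elements of `M` and `N` that have nonzero image under
`R`-linear maps to `k`, then `Tor₁(M, N)` is nonzero. -/
theorem not_subsingleton_tor_one {R k : Type} [CommRing R] [Field k] [Algebra R k]
    (hk : Function.Surjective (algebraMap R k)) (M N : ModuleCat R)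
    (ψ : M →ₗ[R] k) (χ : N →ₗ[R] k) (θ : RingHom.ker (algebraMap R k) →ₗ[R] k)
    (t : RingHom.ker (algebraMap R k)) (m : M) (n : N)
    (hψ : ψ m ≠ 0) (hχ : χ n ≠ 0) (hθ : θ t ≠ 0)
    (hm : (t : R) • m = 0) (hn : (t : R) • n = 0) :
    ¬ Subsingleton (((Tor (ModuleCat R) 1).obj M).obj N) := by
  intro hTor
  let P := ProjectiveResolution.of N
  let F := (MonoidalCategory.tensoringLeft (ModuleCat R)).obj M
  have hzero : Limits.IsZero (((F.mapHomologicalComplex _).obj P.complex).homology 1) :=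
    (ModuleCat.isZero_of_subsingleton (((Tor (ModuleCat R) 1).obj M).obj N)).of_iso
      (P.isoLeftDerivedObj F 1).symm
  rw [← HomologicalComplex.exactAt_iff_isZero_homology,
    HomologicalComplex.exactAt_iff' _ 2 1 0 (by simp) (by simp),
    ShortComplex.moduleCat_exact_iff] at hzero
  have h₀ := P.exact₀
  rw [ShortComplex.moduleCat_exact_iff] at h₀
  let ε : P.complex.X 0 ⟶ N := P.π.f 0
  have hε : Function.Surjective ε := (ModuleCat.epi_iff_surjective ε).mp
    (inferInstanceAs (Epi (P.π.f 0)))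
  obtain ⟨x, rfl⟩ := hε n
  obtain ⟨y, hy⟩ := h₀ ((t : R) • x) (by
    change ε ((t : R) • x) = 0
    rw [map_smul, hn])
  have : Module.Projective R (P.complex.X 0) :=
    (IsProjective.iff_projective _).mpr (P.projective 0)
  obtain ⟨g, hg⟩ := Module.projective_lifting_property (Algebra.linearMap R k)
    (χ ∘ₗ ε.hom) hk
  have hg' (z : P.complex.X 0) : algebraMap R k (g z) = χ (ε z) := LinearMap.congr_fun hg z
  have hdε (z : P.complex.X 1) : ε (P.complex.d 1 0 z) = 0 :=
    ConcreteCategory.congr_hom P.complex_d_comp_π_f_zero z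
  have hdd (z : P.complex.X 2) : P.complex.d 1 0 (P.complex.d 2 1 z) = 0 :=
    ConcreteCategory.congr_hom (P.complex.d_comp_d 2 1 0) z
  let φ : P.complex.X 1 →ₗ[R] k := θ ∘ₗ LinearMap.codRestrict (RingHom.ker (algebraMap R k))
    (g ∘ₗ (P.complex.d 1 0).hom) (fun z => by
      change algebraMap R k (g (P.complex.d 1 0 z)) = 0
      rw [hg', hdε, map_zero])
  have hφ (z : P.complex.X 2) : φ (P.complex.d 2 1 z) = 0 := by
    have : φ (P.complex.d 2 1 z) = θ 0 := by
      refine congrArg θ (Subtype.ext ?_)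
      change g (P.complex.d 1 0 (P.complex.d 2 1 z)) = 0
      rw [hdd, map_zero]
    rw [this, map_zero]
  have hφy : φ y ≠ 0 := by
    have : φ y = θ (g x • t) := by
      refine congrArg θ (Subtype.ext ?_)
      change g (P.complex.d 1 0 y) = g x * t
      rw [show P.complex.d 1 0 y = (t : R) • x from hy, map_smul, smul_eq_mul, mul_comm]
    rw [this, map_smul, Algebra.smul_def, hg']
    exact mul_ne_zero hχ hθ
  obtain ⟨w, hw⟩ := hzero (m ⊗ₜ[R] y) (by
    change m ⊗ₜ[R] (P.complex.d 1 0 y) = 0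
    rw [show P.complex.d 1 0 y = (t : R) • x from hy, ← TensorProduct.smul_tmul, hm,
      TensorProduct.zero_tmul])
  let B : TensorProduct R M (P.complex.X 1) →ₗ[R] k :=
    TensorProduct.lift ((LinearMap.mul R k).compl₁₂ ψ φ)
  have hB : B ∘ₗ LinearMap.lTensor M (P.complex.d 2 1).hom = 0 := by
    refine TensorProduct.ext' fun a b => ?_
    change ψ a * φ (P.complex.d 2 1 b) = 0
    rw [hφ, mul_zero]
  have hBw : B (LinearMap.lTensor M (P.complex.d 2 1).hom w) = 0 := LinearMap.congr_fun hB w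
  have hw' : LinearMap.lTensor M (P.complex.d 2 1).hom w = m ⊗ₜ[R] y := hw
  rw [hw'] at hBw
  exact mul_ne_zero hψ hφy hBw

/-- Lemma 2.4: for finitely generated `S`-modules `M₁, N₁` regarded as modules over the
fiber product `R = S ×ₖ T`, if `Tor_1^R(M₁,N₁) = 0` then `M₁ = 0` or `N₁ = 0`. -/
theorem stmt_4 (S T k : Type) [CommRing S] [CommRing T] [Field k]
    [IsNoetherianRing S] [IsNoetherianRing T] [IsLocalRing S] [IsLocalRing T]
    (πS : S →+* k) (πT : T →+* k)
    (hπS : Function.Surjective πS) (hπT : Function.Surjective πT)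
    (hkS : RingHom.ker πS = maximalIdeal S) (hkT : RingHom.ker πT = maximalIdeal T)
    (hS : maximalIdeal S ≠ ⊥) (hT : maximalIdeal T ≠ ⊥)
    (M1 N1 : Type) [AddCommGroup M1] [Module S M1] [Module.Finite S M1]
    [AddCommGroup N1] [Module S N1] [Module.Finite S N1] :
    letI : Module ↥(fiberProd πS πT) M1 := Module.compHom M1 (ρS πS πT)
    letI : Module ↥(fiberProd πS πT) N1 := Module.compHom N1 (ρS πS πT)
    TorZero ↥(fiberProd πS πT) M1 N1 1 → Subsingleton M1 ∨ Subsingleton N1 := by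
  intro hTor
  let _ : Module (fiberProd πS πT) M1 := Module.compHom M1 (ρS πS πT)
  let _ : Module (fiberProd πS πT) N1 := Module.compHom N1 (ρS πS πT)
  by_contra! hne
  obtain ⟨_, _⟩ := hne
  have : Nontrivial (maximalIdeal T) := Submodule.nontrivial_iff_ne_bot.mpr hT
  obtain ⟨ψ, m, hψ⟩ := exists_semilinearMap_residue_ne_zero (N := M1) πS hkS
  obtain ⟨χ, n, hχ⟩ := exists_semilinearMap_residue_ne_zero (N := N1) πS hkS
  obtain ⟨θ, t, hθ⟩ := exists_semilinearMap_residue_ne_zero (N := maximalIdeal T) πT hkT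
  let _ : Algebra (fiberProd πS πT) k := (πS.comp (ρS πS πT)).toAlgebra
  have hπ (r : fiberProd πS πT) : πS r.1.1 = πT r.1.2 := r.2
  have hsurj : Function.Surjective (algebraMap (fiberProd πS πT) k) := fun a => by
    obtain ⟨s, rfl⟩ := hπS a
    obtain ⟨u, hu⟩ := hπT (πS s)
    exact ⟨⟨(s, u), hu.symm⟩, rfl⟩
  have hmem (r : RingHom.ker (algebraMap (fiberProd πS πT) k)) : r.1.1.2 ∈ maximalIdeal T := by
    rw [← hkT, RingHom.mem_ker, ← hπ]
    exact r.2
  have ht : πT t = 0 := by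
    rw [← RingHom.mem_ker, hkT]
    exact t.2
  refine not_subsingleton_tor_one hsurj (ModuleCat.of _ M1) (ModuleCat.of _ N1)
    { toFun := ψ, map_add' := ψ.map_add, map_smul' := fun r x => ψ.map_smulₛₗ r.1.1 x }
    { toFun := χ, map_add' := χ.map_add, map_smul' := fun r x => χ.map_smulₛₗ r.1.1 x }
    { toFun := fun r => θ ⟨r.1.1.2, hmem r⟩
      map_add' := fun r r' => θ.map_add ⟨r.1.1.2, hmem r⟩ ⟨r'.1.1.2, hmem r'⟩
      map_smul' := fun a r => by
        refine (θ.map_smulₛₗ a.1.2 ⟨r.1.1.2, hmem r⟩).trans ?_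
        rw [← hπ]
        rfl }
    ⟨⟨(0, t), by simpa [fiberProd] using ht.symm⟩, πS.map_zero⟩ m n hψ hχ hθ
    (zero_smul S m) (zero_smul S n) hTor
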